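/- Let M > 0 and a ∈ ℝ with 0 < |a| < M. Set r_± = M ± √(M² − a²), Δ(r) = r² − 2Mr + a² (so Δ(r) = (r − r_+)(r − r_−)), and κ₋ = (r_− − r_+)/(2(r_−² + a²)) < 0. Let r* : (r_−, r_+) → ℝ be a differentiable function with (r*)′(r) = (r² + a²)/Δ(r) for all r ∈ (r_−, r_+). Then for every r₀ ∈ (r_−, r_+) there exists C > 0 such that for all r ∈ (r_−, r₀]: (1/(2κ₋))·log(r − r_−) − C ≤ r*(r) ≤ (1/(2κ₋))·log(r − r_−) + C. Equivalently, there exist constants 0 < c₁ ≤ c₂ with c₁·(r − r_−) ≤ e^{2κ₋ r*(r)} ≤ c₂·(r − r_−) for all r ∈ (r_−, r₀]. -/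

import Mathlib

open Set

/-- Asymptotics of the tortoise coordinate near the Kerr Cauchy horizon (equation (3.3)
of the paper): `r*` equals `(1/(2κ₋)) log(r - r₋)` up to a bounded error on `(r₋, r₀]`;
equivalently `e^{2κ₋ r*} ≍ r - r₋` there. -/
theorem tortoise_coordinate_asymptotics (M a : ℝ) (ha : 0 < |a|) (haM : |a| < M)
    (rp rm κ : ℝ) (hrp : rp = M + Real.sqrt (M ^ 2 - a ^ 2))
    (hrm : rm = M - Real.sqrt (M ^ 2 - a ^ 2))
    (hκ : κ = (rm - rp) / (2 * (rm ^ 2 + a ^ 2)))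
    (rstar : ℝ → ℝ)
    (hderiv : ∀ r ∈ Ioo rm rp,
      HasDerivAt rstar ((r ^ 2 + a ^ 2) / (r ^ 2 - 2 * M * r + a ^ 2)) r) :
    ∀ r₀ ∈ Ioo rm rp,
      (∃ C > 0, ∀ r ∈ Ioc rm r₀,
        (1 / (2 * κ)) * Real.log (r - rm) - C ≤ rstar r ∧
        rstar r ≤ (1 / (2 * κ)) * Real.log (r - rm) + C) ∧
      (∃ c₁ c₂ : ℝ, 0 < c₁ ∧ c₁ ≤ c₂ ∧ ∀ r ∈ Ioc rm r₀,
        c₁ * (r - rm) ≤ Real.exp (2 * κ * rstar r) ∧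
        Real.exp (2 * κ * rstar r) ≤ c₂ * (r - rm)) := by
  have haM2 : 0 < M ^ 2 - a ^ 2 := by
    have := sq_lt_sq' (by linarith [abs_nonneg a]) haM
    rw [sq_abs] at this
    linarith
  have hs := Real.sqrt_pos.mpr haM2
  have hs2 := Real.sq_sqrt haM2.le
  have ha2 : 0 < a ^ 2 := by
    have := abs_pos.mp ha
    positivity
  set s := Real.sqrt (M ^ 2 - a ^ 2) with hsdef
  have hlt : rm < rp := by linarith
  have hΔ : ∀ r, r ^ 2 - 2 * M * r + a ^ 2 = (r - rm) * (r - rp) := by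
    intro r; rw [hrm, hrp]; linear_combination hs2
  have hpos : 0 < rm ^ 2 + a ^ 2 := by positivity
  have hne : rm - rp ≠ 0 := by linarith
  have hκ0 : κ ≠ 0 := by
    rw [hκ]; exact div_ne_zero hne (by positivity)
  have hA : 1 / (2 * κ) = (rm ^ 2 + a ^ 2) / (rm - rp) := by
    rw [hκ]; field_simp
  set A := 1 / (2 * κ) with hAdef
  set B := (rp ^ 2 + a ^ 2) / (rp - rm) with hB
  have hder : ∀ r ∈ Ioo rm rp, HasDerivAt
      (fun r => rstar r - (A * Real.log (r - rm) + (r + B * Real.log (rp - r)))) 0 r := by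
    intro r hr
    have h1 : r - rm ≠ 0 := by linarith [hr.1]
    have h2 : rp - r ≠ 0 := by linarith [hr.2]
    have h2' : r - rp ≠ 0 := by linarith [hr.2]
    have h3 : rp - rm ≠ 0 := by linarith
    have d1 := (((hasDerivAt_id r).sub_const rm).log h1).const_mul A
    have d2 := (((hasDerivAt_id r).const_sub rp).log h2).const_mul B
    have d := (hderiv r hr).sub (d1.add ((hasDerivAt_id r).add d2))
    refine d.congr_deriv ?_
    simp only [id]
    rw [hΔ, hA, hB]
    rw [show rp - r = -(r - rp) by ring, show rp - rm = -(rm - rp) by ring]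
    field_simp
    ring
  obtain ⟨K, hK⟩ := isOpen_Ioo.exists_is_const_of_deriv_eq_zero
    (isPreconnected_Ioo (a := rm) (b := rp))
    (fun r hr => (hder r hr).differentiableAt.differentiableWithinAt)
    (fun r hr => (hder r hr).deriv)
  intro r₀ hr₀
  have hcont : ContinuousOn (fun r => r + B * Real.log (rp - r) + K) (Icc rm r₀) := by
    refine ContinuousOn.add (continuousOn_id.add (continuousOn_const.mul
      (ContinuousOn.log (by fun_prop) ?_))) continuousOn_const
    intro r hr
    have := hr.2
    have := hr₀.2
    linarith
  obtain ⟨D, hD⟩ := isCompact_Icc.exists_bound_of_continuousOn hcont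
  have key : ∀ r ∈ Ioc rm r₀, |rstar r - A * Real.log (r - rm)| ≤ |D| + 1 := by
    intro r hr
    have h1 := hD r ⟨hr.1.le, hr.2⟩
    have h2 := hK r ⟨hr.1, hr.2.trans_lt hr₀.2⟩
    rw [Real.norm_eq_abs] at h1
    have h3 : rstar r - A * Real.log (r - rm) = r + B * Real.log (rp - r) + K := by
      linarith
    rw [h3]
    linarith [le_abs_self D]
  have hC : 0 < |D| + 1 := by positivity
  set C := |D| + 1
  refine ⟨⟨C, hC, fun r hr => ?_⟩, Real.exp (-(|2 * κ| * C)), Real.exp (|2 * κ| * C),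
    Real.exp_pos _, Real.exp_le_exp.mpr ?_, fun r hr => ?_⟩
  · have := abs_le.mp (key r hr)
    constructor <;> linarith [this.1, this.2]
  · have : 0 ≤ |2 * κ| * C := by positivity
    linarith
  · have h0 : 0 < r - rm := by linarith [hr.1]
    have h1 : |2 * κ * (rstar r - A * Real.log (r - rm))| ≤ |2 * κ| * C := by
      rw [abs_mul]
      exact mul_le_mul_of_nonneg_left (key r hr) (abs_nonneg _)
    have h2 : 2 * κ * rstar r
        = 2 * κ * (rstar r - A * Real.log (r - rm)) + Real.log (r - rm) := by
      have : 2 * κ * A = 1 := by rw [hAdef]; field_simp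
      linear_combination (Real.log (r - rm)) * this
    have h3 := abs_le.mp h1
    rw [h2, Real.exp_add, Real.exp_log h0]
    exact ⟨mul_le_mul_of_nonneg_right (Real.exp_le_exp.mpr h3.1) h0.le,
      mul_le_mul_of_nonneg_right (Real.exp_le_exp.mpr h3.2) h0.le⟩
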